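/- Let n, d, D be natural numbers and A ∈ ℝ^{d×D}. Then for all X, Y ∈ ℝ^{n×d}, ‖β_A(X) − β_A(Y)‖_F ≤ σ_1(A) · dist(X,Y); i.e., the upper Lipschitz constant of β_A with respect to dist is at most the largest singular value of A. -/

import Mathlib

open Matrix MeasureTheory

/-- `sortVec v` rearranges the entries of `v` in non-decreasing order. -/
noncomputable def sortVec {n : ℕ} (v : Fin n → ℝ) : Fin n → ℝ := v ∘ Tuple.sort v

/-- The sorting-based embedding `β_A`: the `k`-th column of `β_A X` is `sort (X a_k)`,
where `a_k` is the `k`-th column of `A`. -/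
noncomputable def betaEmb {n d D : ℕ} (A : Matrix (Fin d) (Fin D) ℝ)
    (X : Matrix (Fin n) (Fin d) ℝ) : Matrix (Fin n) (Fin D) ℝ :=
  Matrix.of fun i k => sortVec (X.mulVec fun l => A l k) i

/-- Frobenius norm of a real matrix. -/
noncomputable def frob {n m : ℕ} (M : Matrix (Fin n) (Fin m) ℝ) : ℝ :=
  Real.sqrt (∑ i, ∑ j, (M i j) ^ 2)

/-- `dist(X,Y) = min_{σ ∈ S_n} ‖X - σY‖_F`, where `σ` acts by permuting rows. -/
noncomputable def permDist {n d : ℕ} (X Y : Matrix (Fin n) (Fin d) ℝ) : ℝ :=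
  ⨅ σ : Equiv.Perm (Fin n), frob (X - Y.submatrix σ id)

/-- `singularValue M k` is the `k`-th largest singular value of `M` (1-based), i.e. the
square root of the `k`-th largest eigenvalue of `M * Mᴴ`; it is `0` when `k - 1 ≥ d`. -/
noncomputable def singularValue {d D : ℕ} (M : Matrix (Fin d) (Fin D) ℝ) (k : ℕ) : ℝ :=
  if h : k - 1 < d then
    Real.sqrt (-(sortVec
      (fun i => -((Matrix.isHermitian_mul_conjTranspose_self M).eigenvalues i)) ⟨k - 1, h⟩))
  else 0

/-- Sorting is invariant under permutations of the entries. -/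
theorem sortVec_comp_perm {n : ℕ} (v : Fin n → ℝ) (σ : Equiv.Perm (Fin n)) :
    sortVec (v ∘ σ) = sortVec v :=
  Tuple.comp_perm_comp_sort_eq_comp_sort

/-- Sorting is non-expansive for the Euclidean distance. -/
theorem sum_sq_sortVec_sub_le {n : ℕ} (u v : Fin n → ℝ) :
    ∑ i, (sortVec u i - sortVec v i) ^ 2 ≤ ∑ i, (u i - v i) ^ 2 := by
  have hu : ∑ i, sortVec u i ^ 2 = ∑ i, u i ^ 2 :=
    Equiv.sum_comp (Tuple.sort u) fun i => u i ^ 2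
  have hv : ∑ i, sortVec v i ^ 2 = ∑ i, v i ^ 2 :=
    Equiv.sum_comp (Tuple.sort v) fun i => v i ^ 2
  have hmono : Monovary (sortVec u) (sortVec v) :=
    (Tuple.monotone_sort u).monovary (Tuple.monotone_sort v)
  have huv : ∑ i, u i * v i ≤ ∑ i, sortVec u i * sortVec v i := by
    have h := hmono.sum_mul_comp_perm_le_sum_mul (σ := (Tuple.sort u).trans (Tuple.sort v).symm)
    refine le_of_eq_of_le ?_ h
    rw [← Equiv.sum_comp (Tuple.sort u) fun i => u i * v i]
    simp [sortVec]
  simp only [sub_sq, Finset.sum_add_distrib, Finset.sum_sub_distrib, hu, hv, mul_assoc,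
    ← Finset.mul_sum]
  linarith

/-- The quadratic form of a real Hermitian matrix is bounded by any upper bound of its
eigenvalues. -/
theorem dotProduct_mulVec_le_of_eigenvalues_le {d : ℕ} {M : Matrix (Fin d) (Fin d) ℝ}
    (hM : M.IsHermitian) {c : ℝ} (hc : ∀ i, hM.eigenvalues i ≤ c) (w : Fin d → ℝ) :
    w ⬝ᵥ M *ᵥ w ≤ c * (w ⬝ᵥ w) := by
  let b := hM.eigenvectorBasis
  have hb (x y : Fin d → ℝ) : x ⬝ᵥ y = ∑ i, (x ⬝ᵥ (b i).ofLp) * (y ⬝ᵥ (b i).ofLp) := by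
    have h := b.sum_inner_mul_inner (WithLp.toLp 2 x) (WithLp.toLp 2 y)
    simp only [EuclideanSpace.inner_eq_star_dotProduct, star_trivial] at h
    rw [dotProduct_comm x y, ← h]
    simp only [dotProduct_comm]
  have hMb (i : Fin d) : (M *ᵥ w) ⬝ᵥ (b i).ofLp = hM.eigenvalues i * (w ⬝ᵥ (b i).ofLp) := by
    have ht : Mᵀ = M := by simpa [conjTranspose_eq_transpose_of_trivial] using hM.eq
    rw [dotProduct_comm, dotProduct_mulVec, ← mulVec_transpose, ht, hM.mulVec_eigenvectorBasis,
      smul_dotProduct, smul_eq_mul, dotProduct_comm]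
  rw [hb w (M *ᵥ w), hb w w, Finset.mul_sum]
  refine Finset.sum_le_sum fun i _ => ?_
  rw [hMb]
  nlinarith [mul_le_mul_of_nonneg_right (hc i) (mul_self_nonneg (w ⬝ᵥ (b i).ofLp))]

theorem eigenvalues_le_singularValue_one_sq {d D : ℕ} (A : Matrix (Fin d) (Fin D) ℝ) (i : Fin d) :
    (isHermitian_mul_conjTranspose_self A).eigenvalues i ≤ singularValue A 1 ^ 2 := by
  have hd : 1 - 1 < d := Nat.zero_lt_of_lt i.isLt
  rw [singularValue, dif_pos hd]
  set f : Fin d → ℝ := fun i => -(isHermitian_mul_conjTranspose_self A).eigenvalues i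
  have hle : sortVec f ⟨1 - 1, hd⟩ ≤ f i := by
    have h := Tuple.monotone_sort f
      (show (⟨1 - 1, hd⟩ : Fin d) ≤ (Tuple.sort f).symm i from Nat.zero_le _)
    simpa [sortVec] using h
  have hi : f i = -(isHermitian_mul_conjTranspose_self A).eigenvalues i := rfl
  exact (show _ ≤ -(sortVec f ⟨1 - 1, hd⟩) by linarith).trans
    (Real.sq_sqrt'.symm ▸ le_max_left _ _)

theorem singularValue_nonneg {d D : ℕ} (A : Matrix (Fin d) (Fin D) ℝ) (k : ℕ) :
    0 ≤ singularValue A k := by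
  unfold singularValue
  split_ifs
  exacts [Real.sqrt_nonneg _, le_rfl]

theorem frob_mul_le {n d D : ℕ} (Z : Matrix (Fin n) (Fin d) ℝ) (A : Matrix (Fin d) (Fin D) ℝ) :
    frob (Z * A) ≤ singularValue A 1 * frob Z := by
  have hrow (i : Fin n) :
      ∑ k, (Z * A) i k ^ 2 ≤ singularValue A 1 ^ 2 * ∑ j, Z i j ^ 2 := by
    have h := dotProduct_mulVec_le_of_eigenvalues_le (isHermitian_mul_conjTranspose_self A)
      (eigenvalues_le_singularValue_one_sq A) (Z i)
    rw [conjTranspose_eq_transpose_of_trivial, ← mulVec_mulVec, dotProduct_mulVec,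
      mulVec_transpose] at h
    simp only [dotProduct, ← sq] at h
    exact h
  unfold frob
  rw [← Real.sqrt_sq (singularValue_nonneg A 1), ← Real.sqrt_mul (sq_nonneg _), Finset.mul_sum]
  exact Real.sqrt_le_sqrt (Finset.sum_le_sum fun i _ => hrow i)

theorem betaEmb_submatrix_perm {n d D : ℕ} (A : Matrix (Fin d) (Fin D) ℝ)
    (Y : Matrix (Fin n) (Fin d) ℝ) (σ : Equiv.Perm (Fin n)) :
    betaEmb A (Y.submatrix σ id) = betaEmb A Y := by
  ext i k
  exact congrFun (sortVec_comp_perm (Y *ᵥ fun l => A l k) σ) i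

theorem frob_betaEmb_sub_le {n d D : ℕ} (A : Matrix (Fin d) (Fin D) ℝ)
    (X Y : Matrix (Fin n) (Fin d) ℝ) :
    frob (betaEmb A X - betaEmb A Y) ≤ frob ((X - Y) * A) := by
  refine Real.sqrt_le_sqrt ?_
  rw [Finset.sum_comm, Finset.sum_comm (f := fun i j => ((X - Y) * A) i j ^ 2)]
  refine Finset.sum_le_sum fun k _ => ?_
  rw [Matrix.sub_mul]
  exact sum_sq_sortVec_sub_le (X *ᵥ fun l => A l k) (Y *ᵥ fun l => A l k)

/-- The upper Lipschitz constant of `β_A` with respect to `dist` is at most the largest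
singular value of `A`. -/
theorem stmt19 (n d D : ℕ) (A : Matrix (Fin d) (Fin D) ℝ) (X Y : Matrix (Fin n) (Fin d) ℝ) :
    frob (betaEmb A X - betaEmb A Y) ≤ singularValue A 1 * permDist X Y := by
  obtain ⟨σ, hσ⟩ := exists_eq_ciInf_of_finite
    (f := fun σ : Equiv.Perm (Fin n) => frob (X - Y.submatrix σ id))
  rw [permDist, ← hσ, ← betaEmb_submatrix_perm A Y σ]
  exact (frob_betaEmb_sub_le A X _).trans (frob_mul_le _ A)
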